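/- Let p, q ∈ (1, ∞) be conjugate exponents (1/p + 1/q = 1). Let ‖·‖ be a norm on ℝ^k with dual norm ‖y‖_* = sup_{‖x‖ ≤ 1} ⟨x, y⟩, and let h : ℝ^k → ℝ^k satisfy ⟨h(y), y⟩ = ‖y‖_* and ‖h(y)‖ ≤ 1 for all y. Let l : ℝ^k → ℝ be Lipschitz continuous and differentiable at each of the points X_1, …, X_N ∈ ℝ^k, let μ = (1/N) Σ_{n=1}^N δ_{X_n}, and assume Υ := ((1/N) Σ_{n=1}^N ‖∇l(X_n)‖_*^q)^{1/q} > 0. For δ ≥ 0 define X̂_n(δ) = X_n + δ · h(∇l(X_n)) ‖∇l(X_n)‖_*^{q−1} Υ^{1−q}, V(δ) = sup { ∫ l dη : η a probability measure on ℝ^k with W_p(μ, η) ≤ δ }, and V^e(δ) = sup { (1/N) Σ_{n=1}^N l(X̂_n) : X̂_1, …, X̂_N ∈ ℝ^k with ((1/N) Σ_{n=1}^N ‖X_n − X̂_n‖^p)^{1/p} ≤ δ }. Then for every δ ≥ 0: (1/N) Σ_{n=1}^N l(X̂_n(δ)) ≤ V^e(δ) ≤ V(δ). -/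

import Mathlib

open MeasureTheory Filter
open scoped ENNReal NNReal

noncomputable section

/-- The standard inner product pairing on `ℝ^k`. -/
def pairing {k : ℕ} (x y : Fin k → ℝ) : ℝ := ∑ i, x i * y i

/-- `nrm` is a norm on `ℝ^k`. -/
structure IsNorm {k : ℕ} (nrm : (Fin k → ℝ) → ℝ) : Prop where
  triangle : ∀ x y, nrm (x + y) ≤ nrm x + nrm y
  smul : ∀ (c : ℝ) (x : Fin k → ℝ), nrm (c • x) = |c| * nrm x
  pos : ∀ x, x ≠ 0 → 0 < nrm x

/-- The dual norm `‖y‖_* = sup_{‖x‖ ≤ 1} ⟨x, y⟩`. -/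
def dualNorm {k : ℕ} (nrm : (Fin k → ℝ) → ℝ) (y : Fin k → ℝ) : ℝ :=
  sSup {r | ∃ x, nrm x ≤ 1 ∧ r = pairing x y}

/-- The gradient of `l : ℝ^k → ℝ` with respect to the standard basis. -/
def grad {k : ℕ} (l : (Fin k → ℝ) → ℝ) (x : Fin k → ℝ) : Fin k → ℝ :=
  fun i => fderiv ℝ l x (Pi.single i 1)

/-- The `p`-Wasserstein distance (with respect to the norm `nrm`), as an
infimum over all couplings of `μ` and `ν`. -/
def Wp {k : ℕ} (p : ℝ) (nrm : (Fin k → ℝ) → ℝ) (μ ν : Measure (Fin k → ℝ)) : ℝ≥0∞ :=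
  ⨅ (π : Measure ((Fin k → ℝ) × (Fin k → ℝ))) (_ : IsProbabilityMeasure π)
    (_ : π.map Prod.fst = μ) (_ : π.map Prod.snd = ν),
    (∫⁻ z, ENNReal.ofReal (nrm (z.1 - z.2) ^ p) ∂π) ^ (1 / p)

/-- The robust value `V(δ) = sup { ∫ l dη : W_p(μ, η) ≤ δ }`. -/
def Vrob {k : ℕ} (p : ℝ) (nrm : (Fin k → ℝ) → ℝ) (l : (Fin k → ℝ) → ℝ)
    (μ : Measure (Fin k → ℝ)) (δ : ℝ) : ℝ :=
  sSup {r | ∃ η : Measure (Fin k → ℝ), IsProbabilityMeasure η ∧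
    Wp p nrm μ η ≤ ENNReal.ofReal δ ∧ r = ∫ x, l x ∂η}

/-- The empirical robust value `V^e(δ)`: the supremum of the empirical averages of `l`
over all perturbed datasets within an empirical `p`-Wasserstein budget `δ`. -/
def Vemp {k : ℕ} (p : ℝ) (nrm : (Fin k → ℝ) → ℝ) (l : (Fin k → ℝ) → ℝ)
    (N : ℕ) (X : Fin N → Fin k → ℝ) (δ : ℝ) : ℝ :=
  sSup {r | ∃ Y : Fin N → Fin k → ℝ,
    ((1 / (N : ℝ)) * ∑ n, nrm (X n - Y n) ^ p) ^ (1 / p) ≤ δ ∧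
    r = (1 / (N : ℝ)) * ∑ n, l (Y n)}

namespace IsNorm

variable {k : ℕ} {nrm : (Fin k → ℝ) → ℝ}

lemma map_zero (hnrm : IsNorm nrm) : nrm 0 = 0 := by
  simpa using hnrm.smul 0 0

lemma nonneg (hnrm : IsNorm nrm) (x : Fin k → ℝ) : 0 ≤ nrm x := by
  by_cases hx : x = 0
  · rw [hx, hnrm.map_zero]
  · exact (hnrm.pos x hx).le

lemma map_neg (hnrm : IsNorm nrm) (x : Fin k → ℝ) : nrm (-x) = nrm x := by
  simpa using hnrm.smul (-1) x

lemma convexOn (hnrm : IsNorm nrm) : ConvexOn ℝ Set.univ nrm := by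
  refine ⟨convex_univ, fun x _ y _ a b ha hb _ => (hnrm.triangle _ _).trans ?_⟩
  rw [hnrm.smul, hnrm.smul, abs_of_nonneg ha, abs_of_nonneg hb, smul_eq_mul, smul_eq_mul]

lemma continuous (hnrm : IsNorm nrm) : Continuous nrm :=
  hnrm.convexOn.locallyLipschitz.continuous

/-- The supremum norm is dominated by any norm on `ℝ^k`. -/
lemma exists_norm_le (hnrm : IsNorm nrm) : ∃ C : ℝ, 0 ≤ C ∧ ∀ x, ‖x‖ ≤ C * nrm x := by
  rcases (Metric.sphere (0 : Fin k → ℝ) 1).eq_empty_or_nonempty with he | hne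
  · refine ⟨0, le_rfl, fun x => ?_⟩
    by_contra! hx
    rw [zero_mul] at hx
    have hmem : ‖x‖⁻¹ • x ∈ Metric.sphere (0 : Fin k → ℝ) 1 := by
      simp [norm_smul, hx.ne']
    simp [he] at hmem
  · obtain ⟨z, hz, hmin⟩ :=
      (isCompact_sphere (0 : Fin k → ℝ) 1).exists_isMinOn hne hnrm.continuous.continuousOn
    have hz0 : 0 < nrm z := hnrm.pos z (by rintro rfl; simp at hz)
    refine ⟨(nrm z)⁻¹, by positivity, fun x => ?_⟩
    by_cases hx : x = 0
    · simp [hx, hnrm.map_zero]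
    · have hx' : 0 < ‖x‖ := norm_pos_iff.2 hx
      have hmem : ‖x‖⁻¹ • x ∈ Metric.sphere (0 : Fin k → ℝ) 1 := by
        simp [norm_smul, hx'.ne']
      have hle : nrm z ≤ nrm (‖x‖⁻¹ • x) := hmin hmem
      rw [hnrm.smul, abs_of_pos (inv_pos.2 hx'), inv_mul_eq_div, le_div_iff₀ hx'] at hle
      rw [inv_mul_eq_div, le_div_iff₀ hz0]
      linarith

lemma dualNorm_nonneg (hnrm : IsNorm nrm) (y : Fin k → ℝ) : 0 ≤ dualNorm nrm y := by
  by_cases hb : BddAbove {r | ∃ x, nrm x ≤ 1 ∧ r = pairing x y}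
  · exact le_csSup hb ⟨0, by simp [hnrm.map_zero], by simp [pairing]⟩
  · exact (Real.sSup_of_not_bddAbove hb).ge

end IsNorm

/-- The uniform probability measure on the points `x 0, …, x (N - 1)`. -/
def empiricalMeasure {α : Type*} [MeasurableSpace α] {N : ℕ} (x : Fin N → α) : Measure α :=
  (N : ℝ≥0∞)⁻¹ • ∑ n, Measure.dirac (x n)

section empiricalMeasure

variable {α β : Type*} [MeasurableSpace α] [MeasurableSpace β] {N : ℕ}

lemma isProbabilityMeasure_empiricalMeasure (hN : 0 < N) (x : Fin N → α) :
    IsProbabilityMeasure (empiricalMeasure x) := by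
  refine ⟨?_⟩
  have hN' : (N : ℝ≥0∞) ≠ 0 := by exact_mod_cast hN.ne'
  simp [empiricalMeasure, ENNReal.inv_mul_cancel hN' (ENNReal.natCast_ne_top N)]

lemma map_empiricalMeasure (x : Fin N → α) {f : α → β} (hf : Measurable f) :
    (empiricalMeasure x).map f = empiricalMeasure fun n => f (x n) := by
  rw [empiricalMeasure, empiricalMeasure, Measure.map_smul,
    Measure.map_finset_sum' hf.aemeasurable]
  simp [Measure.map_dirac' hf]

lemma lintegral_empiricalMeasure [MeasurableSingletonClass α] (x : Fin N → α) (f : α → ℝ≥0∞) :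
    ∫⁻ a, f a ∂empiricalMeasure x = (N : ℝ≥0∞)⁻¹ * ∑ n, f (x n) := by
  simp [empiricalMeasure, lintegral_finsetSum_measure]

lemma integral_empiricalMeasure [MeasurableSingletonClass α] (x : Fin N → α) (f : α → ℝ) :
    ∫ a, f a ∂empiricalMeasure x = (1 / (N : ℝ)) * ∑ n, f (x n) := by
  rw [empiricalMeasure, integral_smul_measure, integral_finsetSum_measure]
  · simp
  · exact fun n _ => integrable_dirac (by simp)

end empiricalMeasure

section Wasserstein

variable {k N : ℕ} {p : ℝ} {nrm : (Fin k → ℝ) → ℝ}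

lemma Wp_empiricalMeasure_le (hp : 0 < p) (hnrm : IsNorm nrm) (hN : 0 < N)
    (X Y : Fin N → Fin k → ℝ) :
    Wp p nrm (empiricalMeasure X) (empiricalMeasure Y) ≤
      ENNReal.ofReal (((1 / (N : ℝ)) * ∑ n, nrm (X n - Y n) ^ p) ^ (1 / p)) := by
  have hnn : ∀ n, 0 ≤ nrm (X n - Y n) ^ p := fun n => Real.rpow_nonneg (hnrm.nonneg _) _
  refine (iInf_le_of_le (empiricalMeasure fun n => (X n, Y n)) <|
    iInf_le_of_le (isProbabilityMeasure_empiricalMeasure hN _) <|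
    iInf_le_of_le (map_empiricalMeasure _ measurable_fst) <|
    iInf_le_of_le (map_empiricalMeasure _ measurable_snd) le_rfl).trans ?_
  rw [lintegral_empiricalMeasure, ← ENNReal.ofReal_rpow_of_nonneg
    (mul_nonneg (by positivity) (Finset.sum_nonneg fun n _ => hnn n)) (by positivity),
    ENNReal.ofReal_mul (by positivity), ENNReal.ofReal_sum_of_nonneg fun n _ => hnn n,
    one_div (N : ℝ), ENNReal.ofReal_inv_of_pos (by exact_mod_cast hN), ENNReal.ofReal_natCast]

lemma enorm_le_of_lipschitzWith {l : (Fin k → ℝ) → ℝ} {K : ℝ≥0} (hlip : LipschitzWith K l)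
    (hp : 1 ≤ p) (hnrm : IsNorm nrm) {C : ℝ} (hC : 0 ≤ C) (hle : ∀ x, ‖x‖ ≤ C * nrm x)
    (x y : Fin k → ℝ) :
    ‖l y‖ₑ ≤ ‖l x‖ₑ + ENNReal.ofReal (K * C) * (1 + ENNReal.ofReal (nrm (x - y) ^ p)) := by
  have hnn := hnrm.nonneg (x - y)
  have hpow : nrm (x - y) ≤ 1 + nrm (x - y) ^ p := by
    rcases le_total (nrm (x - y)) 1 with h1 | h1
    · linarith [Real.rpow_nonneg hnn p]
    · linarith [Real.self_le_rpow_of_one_le h1 hp]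
  have hl : ‖l x - l y‖ ≤ K * C * (1 + nrm (x - y) ^ p) :=
    calc ‖l x - l y‖ ≤ K * ‖x - y‖ := hlip.norm_sub_le x y
      _ ≤ K * (C * nrm (x - y)) := by gcongr; exact hle _
      _ = K * C * nrm (x - y) := by ring
      _ ≤ K * C * (1 + nrm (x - y) ^ p) := by gcongr
  have htri : ‖l y‖ ≤ ‖l x‖ + K * C * (1 + nrm (x - y) ^ p) := by
    linarith [norm_sub_norm_le (l y) (l x), norm_sub_rev (l x) (l y)]
  have hpnn := Real.rpow_nonneg hnn p
  rw [← ofReal_norm, ← ofReal_norm, ← ENNReal.ofReal_one, ← ENNReal.ofReal_add zero_le_one hpnn,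
    ← ENNReal.ofReal_mul (by positivity), ← ENNReal.ofReal_add (norm_nonneg _) (by positivity)]
  exact ENNReal.ofReal_le_ofReal htri

/-- The robust problem for a Lipschitz function that is integrable for the reference measure
has a bounded value set. -/
lemma bddAbove_Vrob {l : (Fin k → ℝ) → ℝ} {K : ℝ≥0} (hlip : LipschitzWith K l)
    (hp : 1 ≤ p) (hnrm : IsNorm nrm) {μ : Measure (Fin k → ℝ)} (hl : ∫⁻ x, ‖l x‖ₑ ∂μ ≠ ∞)
    (δ : ℝ) :
    BddAbove {r | ∃ η : Measure (Fin k → ℝ), IsProbabilityMeasure η ∧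
      Wp p nrm μ η ≤ ENNReal.ofReal δ ∧ r = ∫ x, l x ∂η} := by
  obtain ⟨C, hC, hle⟩ := hnrm.exists_norm_le
  have hp0 : 0 < p := by linarith
  set B : ℝ≥0∞ := ∫⁻ x, ‖l x‖ₑ ∂μ +
    ENNReal.ofReal (K * C) * (1 + (ENNReal.ofReal δ + 1) ^ p) with hB
  have hBtop : B ≠ ∞ := by
    refine ENNReal.add_ne_top.2 ⟨hl, ENNReal.mul_ne_top ENNReal.ofReal_ne_top ?_⟩
    exact ENNReal.add_ne_top.2 ⟨ENNReal.one_ne_top, ENNReal.rpow_ne_top_of_nonneg hp0.le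
      (ENNReal.add_ne_top.2 ⟨ENNReal.ofReal_ne_top, ENNReal.one_ne_top⟩)⟩
  refine ⟨B.toReal, ?_⟩
  rintro r ⟨η, -, hW, rfl⟩
  have hlt : Wp p nrm μ η < ENNReal.ofReal δ + 1 :=
    hW.trans_lt (ENNReal.lt_add_right ENNReal.ofReal_ne_top one_ne_zero)
  simp only [Wp, iInf_lt_iff] at hlt
  obtain ⟨π, hπ, rfl, rfl, hcost⟩ := hlt
  have hmeas : Measurable fun x => ‖l x‖ₑ := hlip.continuous.measurable.enorm
  have hcost' : ∫⁻ z, ENNReal.ofReal (nrm (z.1 - z.2) ^ p) ∂π ≤ (ENNReal.ofReal δ + 1) ^ p := by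
    rw [one_div] at hcost
    exact (ENNReal.rpow_inv_le_iff hp0).1 hcost.le
  have hint : ‖∫ x, l x ∂π.map Prod.snd‖ₑ ≤ B :=
    calc ‖∫ x, l x ∂π.map Prod.snd‖ₑ ≤ ∫⁻ x, ‖l x‖ₑ ∂π.map Prod.snd :=
          enorm_integral_le_lintegral_enorm _
      _ = ∫⁻ z, ‖l z.2‖ₑ ∂π := lintegral_map hmeas measurable_snd
      _ ≤ ∫⁻ z, (‖l z.1‖ₑ +
            ENNReal.ofReal (K * C) * (1 + ENNReal.ofReal (nrm (z.1 - z.2) ^ p))) ∂π :=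
          lintegral_mono fun z => enorm_le_of_lipschitzWith hlip hp hnrm hC hle z.1 z.2
      _ = ∫⁻ x, ‖l x‖ₑ ∂π.map Prod.fst + ENNReal.ofReal (K * C) *
            (1 + ∫⁻ z, ENNReal.ofReal (nrm (z.1 - z.2) ^ p) ∂π) := by
          have hfst : Measurable fun z : (Fin k → ℝ) × (Fin k → ℝ) => ‖l z.1‖ₑ :=
            hmeas.comp measurable_fst
          rw [lintegral_add_left hfst,
            lintegral_const_mul' _ _ ENNReal.ofReal_ne_top, lintegral_add_left measurable_const,
            lintegral_map hmeas measurable_fst]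
          simp
      _ ≤ B := by rw [hB]; gcongr
  calc ∫ x, l x ∂π.map Prod.snd ≤ ‖∫ x, l x ∂π.map Prod.snd‖ := Real.le_norm_self _
    _ = ‖∫ x, l x ∂π.map Prod.snd‖ₑ.toReal := (toReal_enorm _).symm
    _ ≤ B.toReal := ENNReal.toReal_mono hBtop hint

end Wasserstein

/-- The weights `a n ^ (q - 1)`, normalised by the `q`-mean `M` of `a`, have `p`-mean one. -/
lemma rpow_mean_dual_weights {N : ℕ} {p q : ℝ} (hpq : p.HolderConjugate q)
    {a : Fin N → ℝ} (ha : ∀ n, 0 ≤ a n) {M : ℝ} (hM : 0 < M)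
    (hMa : M = ((1 / (N : ℝ)) * ∑ n, a n ^ q) ^ (1 / q)) {δ : ℝ} (hδ : 0 ≤ δ) :
    ((1 / (N : ℝ)) * ∑ n, (δ * a n ^ (q - 1) * M ^ (1 - q)) ^ p) ^ (1 / p) = δ := by
  have hp0 := hpq.pos
  have hq0 := hpq.symm.pos
  have hexp : (q - 1) * p = q := hpq.symm.sub_one_mul_conj
  have hterm : ∀ n, (δ * a n ^ (q - 1) * M ^ (1 - q)) ^ p = δ ^ p * M ^ (-q) * a n ^ q := by
    intro n
    have han := ha n
    rw [Real.mul_rpow (by positivity) (by positivity), Real.mul_rpow hδ (by positivity),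
      ← Real.rpow_mul han, ← Real.rpow_mul hM.le, hexp,
      show (1 - q) * p = -q by linarith]
    ring
  have hsum : (1 / (N : ℝ)) * ∑ n, a n ^ q = M ^ q := by
    rw [hMa, one_div q, Real.rpow_inv_rpow _ hq0.ne']
    exact mul_nonneg (by positivity) (Finset.sum_nonneg fun n _ => Real.rpow_nonneg (ha n) _)
  simp_rw [hterm]
  rw [← Finset.mul_sum, mul_left_comm, hsum, mul_assoc, ← Real.rpow_add hM, neg_add_cancel,
    Real.rpow_zero, mul_one, one_div, Real.rpow_rpow_inv hδ hp0.ne']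

theorem stmt4 {k : ℕ} (p q : ℝ) (hp : 1 < p) (hq : 1 < q) (hpq : 1 / p + 1 / q = 1)
    (nrm : (Fin k → ℝ) → ℝ) (hnrm : IsNorm nrm)
    (h : (Fin k → ℝ) → (Fin k → ℝ))
    (hdual : ∀ y, pairing (h y) y = dualNorm nrm y)
    (hbound : ∀ y, nrm (h y) ≤ 1)
    (l : (Fin k → ℝ) → ℝ) (hlip : ∃ K : ℝ≥0, LipschitzWith K l)
    (N : ℕ) (hN : 0 < N) (X : Fin N → Fin k → ℝ)
    (hdiff : ∀ n, DifferentiableAt ℝ l (X n))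
    (μ : Measure (Fin k → ℝ))
    (hμ : μ = (N : ℝ≥0∞)⁻¹ • ∑ n, Measure.dirac (X n))
    (Υ : ℝ)
    (hΥ : Υ = ((1 / (N : ℝ)) * ∑ n, dualNorm nrm (grad l (X n)) ^ q) ^ (1 / q))
    (hΥpos : 0 < Υ)
    (Xhat : ℝ → Fin N → Fin k → ℝ)
    (hXhat : ∀ δ n, Xhat δ n =
      X n + (δ * dualNorm nrm (grad l (X n)) ^ (q - 1) * Υ ^ (1 - q)) • h (grad l (X n)))
    (δ : ℝ) (hδ : 0 ≤ δ) :
    (1 / (N : ℝ)) * ∑ n, l (Xhat δ n) ≤ Vemp p nrm l N X δ ∧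
      Vemp p nrm l N X δ ≤ Vrob p nrm l μ δ := by
  have hpq' : p.HolderConjugate q :=
    Real.holderConjugate_iff.2 ⟨hp, by simpa [one_div] using hpq⟩
  have hp0 : 0 < p := hpq'.pos
  obtain ⟨K, hK⟩ := hlip
  have hμ' : μ = empiricalMeasure X := hμ
  have hbdd := bddAbove_Vrob (μ := μ) hK hp.le hnrm (by
    rw [hμ', lintegral_empiricalMeasure]
    refine ENNReal.mul_ne_top (by simp [hN.ne']) ?_
    simp) δ
  have hsub : {r | ∃ Y : Fin N → Fin k → ℝ,
        ((1 / (N : ℝ)) * ∑ n, nrm (X n - Y n) ^ p) ^ (1 / p) ≤ δ ∧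
        r = (1 / (N : ℝ)) * ∑ n, l (Y n)} ⊆
      {r | ∃ η : Measure (Fin k → ℝ), IsProbabilityMeasure η ∧
        Wp p nrm μ η ≤ ENNReal.ofReal δ ∧ r = ∫ x, l x ∂η} := by
    rintro r ⟨Y, hY, rfl⟩
    refine ⟨empiricalMeasure Y, isProbabilityMeasure_empiricalMeasure hN Y, ?_,
      (integral_empiricalMeasure Y l).symm⟩
    rw [hμ']
    exact (Wp_empiricalMeasure_le hp0 hnrm hN X Y).trans (ENNReal.ofReal_le_ofReal hY)
  have hmem : (1 / (N : ℝ)) * ∑ n, l (Xhat δ n) ∈ {r | ∃ Y : Fin N → Fin k → ℝ,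
        ((1 / (N : ℝ)) * ∑ n, nrm (X n - Y n) ^ p) ^ (1 / p) ≤ δ ∧
        r = (1 / (N : ℝ)) * ∑ n, l (Y n)} := by
    refine ⟨Xhat δ, ?_, rfl⟩
    have hd := fun n => hnrm.dualNorm_nonneg (grad l (X n))
    have hc : ∀ n, 0 ≤ δ * dualNorm nrm (grad l (X n)) ^ (q - 1) * Υ ^ (1 - q) := fun n =>
      mul_nonneg (mul_nonneg hδ (Real.rpow_nonneg (hd n) _)) (Real.rpow_nonneg hΥpos.le _)
    refine le_trans ?_ (rpow_mean_dual_weights hpq' hd hΥpos hΥ hδ).le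
    have hnn : ∀ n, 0 ≤ nrm (X n - Xhat δ n) := fun n => hnrm.nonneg _
    have hstep : ∀ n, nrm (X n - Xhat δ n) ≤
        δ * dualNorm nrm (grad l (X n)) ^ (q - 1) * Υ ^ (1 - q) := by
      intro n
      rw [hXhat, sub_add_cancel_left, hnrm.map_neg, hnrm.smul, abs_of_nonneg (hc n)]
      exact mul_le_of_le_one_right (hc n) (hbound _)
    refine Real.rpow_le_rpow (mul_nonneg (by positivity)
      (Finset.sum_nonneg fun n _ => Real.rpow_nonneg (hnn n) _)) ?_ (by positivity)
    gcongr with n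
    · exact hnn n
    · exact hstep n
  exact ⟨le_csSup (hbdd.mono hsub) hmem, csSup_le_csSup hbdd ⟨_, hmem⟩ hsub⟩
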